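/- Let n ≥ 2 and let μ be a locally finite Borel measure on ℝ^n. If μ is 1-rectifiable and μ is absolutely continuous with respect to 1-dimensional Hausdorff measure H¹, then the ordinary L² Jones function satisfies J₂(μ,x) < ∞ at μ-almost every x ∈ ℝ^n. -/

import Mathlib

open MeasureTheory Metric Set Filter
open scoped ENNReal NNReal Topology

noncomputable section

/-- The closed dyadic cube in `ℝⁿ` of generation `k` (side length `2^(-k)`) with corner `z`. -/
def dyadicCube (n : ℕ) (k : ℤ) (z : Fin n → ℤ) : Set (EuclideanSpace ℝ (Fin n)) :=
  {x | ∀ i, (z i : ℝ) * (2 : ℝ) ^ (-k) ≤ x i ∧ x i ≤ ((z i : ℝ) + 1) * (2 : ℝ) ^ (-k)}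

/-- The concentric dilate `λQ` of the dyadic cube `Q` of generation `k` with corner `z`. -/
def dilatedCube (n : ℕ) (lam : ℝ) (k : ℤ) (z : Fin n → ℤ) : Set (EuclideanSpace ℝ (Fin n)) :=
  {x | ∀ i, |x i - ((z i : ℝ) + 1 / 2) * (2 : ℝ) ^ (-k)| ≤ lam * (2 : ℝ) ^ (-k) / 2}

/-- The axis-parallel cube with center `c` and side length `s`. -/
def axisCube {n : ℕ} (c : EuclideanSpace ℝ (Fin n)) (s : ℝ) : Set (EuclideanSpace ℝ (Fin n)) :=
  {x | ∀ i, |x i - c i| ≤ s / 2}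

/-- `L` is an (affine) line in `ℝⁿ`. -/
def IsLine {n : ℕ} (L : Set (EuclideanSpace ℝ (Fin n))) : Prop :=
  ∃ p v : EuclideanSpace ℝ (Fin n), v ≠ 0 ∧ L = {x | ∃ t : ℝ, x = p + t • v}

/-- `β₂(μ,Q)²`, the square of the `L²` beta number of `μ` on `Q`:
`inf_ℓ ∫_Q (dist(x,ℓ)/diam Q)² dμ(x)/μ(Q)`. When `μ Q = 0` this equals `0`,
since `0/0 = 0` in `ℝ≥0∞`. -/
def beta2Sq {n : ℕ} (μ : Measure (EuclideanSpace ℝ (Fin n)))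
    (Q : Set (EuclideanSpace ℝ (Fin n))) : ℝ≥0∞ :=
  ⨅ (L : Set (EuclideanSpace ℝ (Fin n))) (_ : IsLine L),
    (∫⁻ x in Q, ENNReal.ofReal ((Metric.infDist x L / Metric.diam Q) ^ 2) ∂μ) / μ Q

/-- The beta number `β_E(Q) = inf_ℓ sup_{x ∈ E ∩ Q} dist(x,ℓ)/diam Q` of a set `E`;
it is `0` when `E ∩ Q = ∅`. -/
def betaSet {n : ℕ} (E Q : Set (EuclideanSpace ℝ (Fin n))) : ℝ≥0∞ :=
  ⨅ (L : Set (EuclideanSpace ℝ (Fin n))) (_ : IsLine L),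
    ⨆ x ∈ E ∩ Q, ENNReal.ofReal (Metric.infDist x L / Metric.diam Q)

-- The ordinary `L²` Jones function at scale `r`:
-- `J₂(μ,r,x) = Σ_Q β₂²(μ,3Q) χ_Q(x)` over dyadic cubes `Q` of side length at most `r`.
open Classical in
def jones2 {n : ℕ} (μ : Measure (EuclideanSpace ℝ (Fin n))) (r : ℝ)
    (x : EuclideanSpace ℝ (Fin n)) : ℝ≥0∞ :=
  ∑' (k : ℤ) (z : Fin n → ℤ),
    if (2 : ℝ) ^ (-k) ≤ r ∧ x ∈ dyadicCube n k z then beta2Sq μ (dilatedCube n 3 k z) else 0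

-- The density-normalized `L²` Jones function at scale `r`:
-- `J̃₂(μ,r,x) = Σ_Q β₂²(μ,3Q) (diam Q / μ(Q)) χ_Q(x)` over dyadic cubes `Q` of side length
-- at most `r`, with the convention `0/0 = 0` (the term vanishes when `μ Q = 0`).
open Classical in
def jones2Tilde {n : ℕ} (μ : Measure (EuclideanSpace ℝ (Fin n))) (r : ℝ)
    (x : EuclideanSpace ℝ (Fin n)) : ℝ≥0∞ :=
  ∑' (k : ℤ) (z : Fin n → ℤ),
    if (2 : ℝ) ^ (-k) ≤ r ∧ x ∈ dyadicCube n k z then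
      (if μ (dyadicCube n k z) = 0 then 0
       else beta2Sq μ (dilatedCube n 3 k z) * ENNReal.ofReal (Metric.diam (dyadicCube n k z))
              / μ (dyadicCube n k z))
    else 0

/-- A measure `μ` on `ℝⁿ` is `1`-rectifiable: countably many bounded Borel sets `Eᵢ ⊆ ℝ` and
Lipschitz maps `fᵢ : Eᵢ → ℝⁿ` whose images carry the full mass of `μ`. -/
def Is1Rectifiable {n : ℕ} (μ : Measure (EuclideanSpace ℝ (Fin n))) : Prop :=
  ∃ (E : ℕ → Set ℝ) (f : ℕ → ℝ → EuclideanSpace ℝ (Fin n)),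
    (∀ i, Bornology.IsBounded (E i) ∧ MeasurableSet (E i) ∧
      ∃ K : ℝ≥0, LipschitzOnWith K (f i) (E i)) ∧
    μ (Set.univ \ ⋃ i, f i '' E i) = 0

/-- A measure `μ` on `ℝⁿ` is `m`-rectifiable: countably many bounded Borel sets `Eᵢ ⊆ ℝᵐ` and
Lipschitz maps `fᵢ : Eᵢ → ℝⁿ` whose images carry the full mass of `μ`. -/
def IsMRectifiable (m : ℕ) {n : ℕ} (μ : Measure (EuclideanSpace ℝ (Fin n))) : Prop :=
  ∃ (E : ℕ → Set (EuclideanSpace ℝ (Fin m)))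
    (f : ℕ → EuclideanSpace ℝ (Fin m) → EuclideanSpace ℝ (Fin n)),
    (∀ i, Bornology.IsBounded (E i) ∧ MeasurableSet (E i) ∧
      ∃ K : ℝ≥0, LipschitzOnWith K (f i) (E i)) ∧
    μ (Set.univ \ ⋃ i, f i '' E i) = 0

/-- A rectifiable curve in `ℝⁿ`: the image of a Lipschitz map on a compact interval. -/
def IsRectifiableCurve {n : ℕ} (Γ : Set (EuclideanSpace ℝ (Fin n))) : Prop :=
  ∃ (f : ℝ → EuclideanSpace ℝ (Fin n)) (a b : ℝ) (K : ℝ≥0),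
    LipschitzOnWith K f (Set.Icc a b) ∧ Γ = f '' Set.Icc a b

/-- The lower Hausdorff `1`-density `Θ¹_*(μ,x) = liminf_{r→0⁺} μ(B(x,r))/(2r)`. -/
def lowerDensity1 {n : ℕ} (μ : Measure (EuclideanSpace ℝ (Fin n)))
    (x : EuclideanSpace ℝ (Fin n)) : ℝ≥0∞ :=
  Filter.liminf (fun r : ℝ => μ (Metric.closedBall x r) / ENNReal.ofReal (2 * r)) (𝓝[>] 0)

/-- The upper Hausdorff `1`-density `Θ*¹(μ,x) = limsup_{r→0⁺} μ(B(x,r))/(2r)`. -/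
def upperDensity1 {n : ℕ} (μ : Measure (EuclideanSpace ℝ (Fin n)))
    (x : EuclideanSpace ℝ (Fin n)) : ℝ≥0∞ :=
  Filter.limsup (fun r : ℝ => μ (Metric.closedBall x r) / ENNReal.ofReal (2 * r)) (𝓝[>] 0)

/-- The lower Hausdorff `m`-density `Θᵐ_*(μ,x) = liminf_{r→0⁺} μ(B(x,r))/(ω_m rᵐ)`, where
`ω_m` is the Lebesgue volume of the unit ball in `ℝᵐ`. -/
def lowerDensity (m : ℕ) {n : ℕ} (μ : Measure (EuclideanSpace ℝ (Fin n)))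
    (x : EuclideanSpace ℝ (Fin n)) : ℝ≥0∞ :=
  Filter.liminf
    (fun r : ℝ => μ (Metric.closedBall x r) /
      (MeasureTheory.volume (Metric.ball (0 : EuclideanSpace ℝ (Fin m)) 1) *
        ENNReal.ofReal (r ^ m)))
    (𝓝[>] 0)

/-- The `δ`-packing prenumber `P^s_δ(A)`: the supremum of `Σᵢ (2rᵢ)^s` over all countable
packings of `A` by disjoint closed balls centered in `A` of diameter at most `δ`. -/
def packingPreAt {X : Type*} [PseudoMetricSpace X] (s δ : ℝ) (A : Set X) : ℝ≥0∞ :=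
  ⨆ (S : Set (X × ℝ)) (_ : S.Countable)
    (_ : ∀ p ∈ S, p.1 ∈ A ∧ 0 < p.2 ∧ 2 * p.2 ≤ δ)
    (_ : S.Pairwise fun p q => Disjoint (Metric.closedBall p.1 p.2) (Metric.closedBall q.1 q.2)),
    ∑' p : S, ENNReal.ofReal ((2 * p.1.2) ^ s)

/-- The `s`-dimensional packing premeasure `P^s(A) = lim_{δ→0⁺} P^s_δ(A)`; since `P^s_δ(A)`
is nonincreasing in `δ`, the limit equals the infimum over `δ > 0`. -/
def packingPre {X : Type*} [PseudoMetricSpace X] (s : ℝ) (A : Set X) : ℝ≥0∞ :=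
  ⨅ (δ : ℝ) (_ : 0 < δ), packingPreAt s δ A

/-- The `s`-dimensional packing measure
`𝒫^s(A) = inf { Σᵢ P^s(Aᵢ) : A = ⋃ᵢ Aᵢ }`. -/
def packingMeasure {X : Type*} [PseudoMetricSpace X] (s : ℝ) (A : Set X) : ℝ≥0∞ :=
  ⨅ (F : ℕ → Set X) (_ : A = ⋃ i, F i), ∑' i, packingPre s (F i)

section SquareFunction

lemma lintegral_sub_sq_le {V : Type*} [NormedAddCommGroup V] {f : ℝ → V} {K : ℝ≥0}
    (hf : LipschitzWith K f) {a b : ℝ}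
    (ha : ∀ t ≤ a, f t = f a) (hb : ∀ t, b ≤ t → f t = f b) {h : ℝ} (hh : 0 ≤ h) :
    ∫⁻ t, ‖f (t + h) - f t‖ₑ ^ 2 ≤ ENNReal.ofReal ((K * h) ^ 2 * (b - a + h)) := by
  have hsupp : ∀ t, ‖f (t + h) - f t‖ₑ ^ 2 ≤
      (Icc (a - h) b).indicator (fun _ => ENNReal.ofReal ((K * h) ^ 2)) t := fun t => by
    by_cases ht : t ∈ Icc (a - h) b
    · rw [indicator_of_mem ht, ENNReal.ofReal_pow (by positivity), ← ofReal_norm]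
      gcongr
      have := hf.dist_le_mul (t + h) t
      rwa [dist_eq_norm, Real.dist_eq, add_sub_cancel_left, abs_of_nonneg hh] at this
    · rw [indicator_of_notMem ht]
      have : f (t + h) = f t := by
        rw [mem_Icc, not_and_or, not_le, not_le] at ht
        rcases ht with ht | ht
        · rw [ha t (by linarith), ha (t + h) (by linarith)]
        · rw [hb t (by linarith), hb (t + h) (by linarith)]
      simp [this]
  refine (lintegral_mono hsupp).trans ?_
  rw [lintegral_indicator measurableSet_Icc, setLIntegral_const, Real.volume_Icc,
    ← ENNReal.ofReal_mul (by positivity)]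
  apply le_of_eq
  congr 2
  ring

variable {V : Type*} [NormedAddCommGroup V] [InnerProductSpace ℝ V]

/-- The symmetric second difference of `f` at `t` with step `h`. -/
def secondDiff (f : ℝ → V) (t h : ℝ) : V :=
  f (t + h) + f (t - h) - (2 : ℝ) • f t

lemma enorm_add_sq_add_enorm_sub_sq (x y : V) :
    ‖x - y‖ₑ ^ 2 + ‖x + y‖ₑ ^ 2 = 2 * (‖x‖ₑ ^ 2 + ‖y‖ₑ ^ 2) := by
  have h := parallelogram_law_with_norm ℝ x y
  have e : ∀ z : V, ‖z‖ₑ ^ 2 = ENNReal.ofReal (‖z‖ ^ 2) := fun z => by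
    rw [ENNReal.ofReal_pow (norm_nonneg z), ofReal_norm]
  rw [e, e, e, e, ← ENNReal.ofReal_add (by positivity) (by positivity),
    ← ENNReal.ofReal_add (by positivity) (by positivity), ← ENNReal.ofReal_ofNat 2,
    ← ENNReal.ofReal_mul (by positivity), ← h, add_comm]

lemma continuous_secondDiff {f : ℝ → V} (hf : Continuous f) (h : ℝ) :
    Continuous fun t => secondDiff f t h := by
  unfold secondDiff
  fun_prop

lemma lintegral_secondDiff_sq_add {f : ℝ → V} (hf : Continuous f) (h : ℝ) :
    (∫⁻ t, ‖secondDiff f t h‖ₑ ^ 2) + ∫⁻ t, ‖f (t + 2 * h) - f t‖ₑ ^ 2 =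
      4 * ∫⁻ t, ‖f (t + h) - f t‖ₑ ^ 2 := by
  have h1 : ∫⁻ t, ‖f (t + 2 * h) - f t‖ₑ ^ 2 = ∫⁻ t, ‖f (t + h) - f (t - h)‖ₑ ^ 2 := by
    rw [← lintegral_add_right_eq_self (fun t => ‖f (t + h) - f (t - h)‖ₑ ^ 2) h]
    simp only [add_sub_cancel_right, add_assoc, two_mul]
  have h2 : ∫⁻ t, ‖f t - f (t - h)‖ₑ ^ 2 = ∫⁻ t, ‖f (t + h) - f t‖ₑ ^ 2 := by
    rw [← lintegral_add_right_eq_self (fun t => ‖f t - f (t - h)‖ₑ ^ 2) h]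
    simp only [add_sub_cancel_right]
  have hm : Measurable fun t => ‖secondDiff f t h‖ₑ ^ 2 :=
    (continuous_secondDiff hf h).enorm.measurable.pow_const 2
  have hm' : Measurable fun t => ‖f (t + h) - f t‖ₑ ^ 2 :=
    (by fun_prop : Continuous fun t => f (t + h) - f t).enorm.measurable.pow_const 2
  rw [h1, ← lintegral_add_left hm]
  have : ∀ t, ‖secondDiff f t h‖ₑ ^ 2 + ‖f (t + h) - f (t - h)‖ₑ ^ 2 =
      2 * (‖f (t + h) - f t‖ₑ ^ 2 + ‖f t - f (t - h)‖ₑ ^ 2) := fun t => by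
    rw [← enorm_add_sq_add_enorm_sub_sq]
    congr 4
    · rw [secondDiff, two_smul]; abel
    · abel
  simp only [this]
  rw [lintegral_const_mul' _ _ (by simp), lintegral_add_left hm', h2, ← two_mul, ← mul_assoc]
  norm_num

lemma sum_four_pow_mul_lintegral_secondDiff_sq_le {f : ℝ → V} (hf : Continuous f) (H : ℝ)
    (N : ℕ) :
    ∑ j ∈ Finset.range (N + 1), 4 ^ j * ∫⁻ t, ‖secondDiff f t (H / 2 ^ j)‖ₑ ^ 2 ≤
      4 * (4 ^ N * ∫⁻ t, ‖f (t + H / 2 ^ N) - f t‖ₑ ^ 2) := by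
  induction N with
  | zero =>
    have := lintegral_secondDiff_sq_add hf H
    simpa using le_of_le_of_eq le_self_add this
  | succ N ih =>
    rw [Finset.sum_range_succ]
    have := lintegral_secondDiff_sq_add hf (H / 2 ^ (N + 1))
    have e : 2 * (H / 2 ^ (N + 1)) = H / 2 ^ N := by field_simp; ring
    rw [e] at this
    calc _ ≤ 4 * (4 ^ N * ∫⁻ t, ‖f (t + H / 2 ^ N) - f t‖ₑ ^ 2) +
          4 ^ (N + 1) * ∫⁻ t, ‖secondDiff f t (H / 2 ^ (N + 1))‖ₑ ^ 2 := by gcongr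
      _ = 4 ^ (N + 1) * (4 * ∫⁻ t, ‖f (t + H / 2 ^ (N + 1)) - f t‖ₑ ^ 2) := by
          rw [← this]; ring
      _ = _ := by ring

/-- The square function of second differences of a Lipschitz function which is constant on both
sides of a compact interval is integrable. -/
lemma tsum_four_pow_mul_lintegral_secondDiff_sq_lt_top {f : ℝ → V} {K : ℝ≥0}
    (hf : LipschitzWith K f) {a b : ℝ}
    (ha : ∀ t ≤ a, f t = f a) (hb : ∀ t, b ≤ t → f t = f b) {H : ℝ} (hH : 0 ≤ H) :
    ∑' j : ℕ, 4 ^ j * ∫⁻ t, ‖secondDiff f t (H / 2 ^ j)‖ₑ ^ 2 < ⊤ := by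
  refine lt_of_le_of_lt (ENNReal.tsum_le_of_sum_range_le
    (c := ENNReal.ofReal (4 * ((K * H) ^ 2 * (b - a + H)))) fun N => ?_) ENNReal.ofReal_lt_top
  refine (Finset.sum_le_sum_of_subset (Finset.range_mono N.le_succ)).trans
    ((sum_four_pow_mul_lintegral_secondDiff_sq_le hf.continuous H N).trans ?_)
  have hN : H / 2 ^ N ≤ H := div_le_self hH (one_le_pow₀ (by norm_num))
  calc _ ≤ 4 * (4 ^ N * ENNReal.ofReal ((K * (H / 2 ^ N)) ^ 2 * (b - a + H / 2 ^ N))) := by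
        gcongr
        exact lintegral_sub_sq_le hf ha hb (by positivity)
    _ ≤ 4 * (4 ^ N * ENNReal.ofReal ((K * (H / 2 ^ N)) ^ 2 * (b - a + H))) := by
        gcongr
    _ = _ := by
        rw [← ENNReal.ofReal_ofNat 4, ← ENNReal.ofReal_pow (by norm_num),
          ← ENNReal.ofReal_mul (by positivity), ← ENNReal.ofReal_mul (by positivity)]
        congr 1
        rw [mul_pow, mul_pow, div_pow, ← pow_mul, mul_comm N 2, pow_mul]
        norm_num
        field_simp

/-- If all the dyadic second differences of `f` on `[a, a + ℓ]` decay like `(3/4)^i`, then `f`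
stays close to its chord. -/
lemma norm_sub_chord_grid_le {f : ℝ → V} {a ℓ τ : ℝ}
    (hd : ∀ i j : ℕ, j < 2 ^ i →
      ‖secondDiff f (a + (2 * j + 1) * (ℓ / 2 ^ (i + 1))) (ℓ / 2 ^ (i + 1))‖ ≤ τ * (3 / 4) ^ i)
    (i : ℕ) (j : ℕ) (hj : j ≤ 2 ^ i) :
    ‖f (a + j * (ℓ / 2 ^ i)) - (f a + ((j : ℝ) / 2 ^ i) • (f (a + ℓ) - f a))‖ ≤
      2 * τ * (1 - (3 / 4) ^ i) := by
  induction i generalizing j with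
  | zero =>
    have : j = 0 ∨ j = 1 := by simp at hj; omega
    rcases this with rfl | rfl <;> simp
  | succ i ih =>
    have hτ : 0 ≤ τ := by simpa using (norm_nonneg _).trans (hd 0 0 (by norm_num))
    have hmono : 2 * τ * (1 - (3 / 4 : ℝ) ^ i) + τ * (3 / 4) ^ i / 2 =
        2 * τ * (1 - (3 / 4) ^ (i + 1)) := by ring
    obtain ⟨m, rfl | rfl⟩ := Nat.even_or_odd' j
    · have := ih m (by rw [pow_succ] at hj; omega)
      have e1 : ((2 * m : ℕ) : ℝ) * (ℓ / 2 ^ (i + 1)) = m * (ℓ / 2 ^ i) := by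
        push_cast; field_simp; ring
      have e2 : ((2 * m : ℕ) : ℝ) / 2 ^ (i + 1) = m / 2 ^ i := by
        push_cast; field_simp; ring
      rw [e1, e2]
      refine this.trans ?_
      rw [← hmono]
      have : 0 ≤ τ * (3 / 4) ^ i / 2 := by positivity
      linarith
    · have hm : m < 2 ^ i := by rw [pow_succ] at hj; omega
      have h1 := ih m hm.le
      have h2 := ih (m + 1) hm
      have h3 := hd i m hm
      set p : ℝ := a + ((2 * m + 1 : ℕ) : ℝ) * (ℓ / 2 ^ (i + 1)) with hp
      have e1 : a + (2 * m + 1) * (ℓ / 2 ^ (i + 1)) = p := by rw [hp]; push_cast; rfl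
      have e2 : a + ((m + 1 : ℕ) : ℝ) * (ℓ / 2 ^ i) = p + ℓ / 2 ^ (i + 1) := by
        rw [hp]; push_cast; field_simp; ring
      have e3 : a + (m : ℝ) * (ℓ / 2 ^ i) = p - ℓ / 2 ^ (i + 1) := by
        rw [hp]; push_cast; field_simp; ring
      rw [e1, secondDiff] at h3
      rw [e2] at h2
      rw [e3] at h1
      have e4 : ((2 * m + 1 : ℕ) : ℝ) / 2 ^ (i + 1) =
          (1 / 2 : ℝ) * (m / 2 ^ i) + (1 / 2 : ℝ) * (((m + 1 : ℕ) : ℝ) / 2 ^ i) := by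
        push_cast; field_simp; ring
      rw [e4, ← hmono]
      set A := f (p - ℓ / 2 ^ (i + 1))
      set B := f (p + ℓ / 2 ^ (i + 1))
      set W := f (a + ℓ) - f a
      set α := (m : ℝ) / 2 ^ i
      set β := ((m + 1 : ℕ) : ℝ) / 2 ^ i
      have key : f p - (f a + ((1 / 2 : ℝ) * α + (1 / 2 : ℝ) * β) • W) =
          (1 / 2 : ℝ) • (A - (f a + α • W)) + (1 / 2 : ℝ) • (B - (f a + β • W)) -
            (1 / 2 : ℝ) • (B + A - (2 : ℝ) • f p) := by
        module
      rw [key]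
      refine (norm_sub_le _ _).trans ((add_le_add_left (norm_add_le _ _) _).trans ?_)
      rw [norm_smul, norm_smul, norm_smul]
      norm_num
      linarith

lemma norm_sub_chord_le {f : ℝ → V} (hf : Continuous f) {a ℓ τ : ℝ} (hℓ : 0 < ℓ)
    (hd : ∀ i j : ℕ, j < 2 ^ i →
      ‖secondDiff f (a + (2 * j + 1) * (ℓ / 2 ^ (i + 1))) (ℓ / 2 ^ (i + 1))‖ ≤ τ * (3 / 4) ^ i)
    {s : ℝ} (hs : s ∈ Icc a (a + ℓ)) :
    ‖f s - (f a + ((s - a) / ℓ) • (f (a + ℓ) - f a))‖ ≤ 2 * τ := by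
  have hτ : 0 ≤ τ := by simpa using (norm_nonneg _).trans (hd 0 0 (by norm_num))
  set u : ℝ := (s - a) / ℓ with hu
  have hu0 : 0 ≤ u := div_nonneg (by linarith [hs.1]) hℓ.le
  have hu1 : u ≤ 1 := (div_le_one hℓ).2 (by linarith [hs.2])
  have hlim : Tendsto (fun i : ℕ => (⌊u * 2 ^ i⌋₊ : ℝ) / 2 ^ i) atTop (𝓝 u) :=
    (tendsto_nat_floor_mul_div_atTop hu0).comp
      (tendsto_pow_atTop_atTop_of_one_lt (by norm_num : (1 : ℝ) < 2))
  have hcont : Continuous fun w : ℝ => ‖f (a + w * ℓ) - (f a + w • (f (a + ℓ) - f a))‖ := by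
    fun_prop
  have hs' : a + u * ℓ = s := by rw [hu]; field_simp; ring
  have := (hcont.tendsto u).comp hlim
  rw [hs'] at this
  refine le_of_tendsto' this fun i => ?_
  have hfl : ⌊u * 2 ^ i⌋₊ ≤ 2 ^ i := by
    apply Nat.floor_le_of_le
    push_cast
    exact mul_le_of_le_one_left (by positivity) hu1
  have h := norm_sub_chord_grid_le hd i _ hfl
  rw [mul_div_left_comm, mul_comm ℓ] at h
  refine h.trans ?_
  have : 0 ≤ 2 * τ * (3 / 4 : ℝ) ^ i := by positivity
  linarith

/-- A weighted sum of all the dyadic second differences of `f` on `[a, a + ℓ]`, which controls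
the distance from `f` to its chord. -/
def chordEnergy (f : ℝ → V) (a ℓ : ℝ) : ℝ≥0∞ :=
  ∑' i : ℕ, (16 / 9) ^ i * ∑ j ∈ Finset.range (2 ^ i),
    ‖secondDiff f (a + (2 * j + 1) * (ℓ / 2 ^ (i + 1))) (ℓ / 2 ^ (i + 1))‖ₑ ^ 2

lemma enorm_sub_chord_sq_le {f : ℝ → V} (hf : Continuous f) {a ℓ : ℝ} (hℓ : 0 < ℓ)
    {s : ℝ} (hs : s ∈ Icc a (a + ℓ)) :
    ‖f s - (f a + ((s - a) / ℓ) • (f (a + ℓ) - f a))‖ₑ ^ 2 ≤ 4 * chordEnergy f a ℓ := by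
  by_cases htop : chordEnergy f a ℓ = ⊤
  · simp [htop]
  set T := chordEnergy f a ℓ with hT
  have hd : ∀ i j : ℕ, j < 2 ^ i →
      ‖secondDiff f (a + (2 * j + 1) * (ℓ / 2 ^ (i + 1))) (ℓ / 2 ^ (i + 1))‖ ≤
        √T.toReal * (3 / 4) ^ i := fun i j hj => by
    set D := secondDiff f (a + (2 * j + 1) * (ℓ / 2 ^ (i + 1))) (ℓ / 2 ^ (i + 1)) with hD
    have h1 : (16 / 9) ^ i * ‖D‖ₑ ^ 2 ≤ T := by
      refine le_trans ?_ (ENNReal.le_tsum i)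
      gcongr
      exact Finset.single_le_sum (f := fun j : ℕ =>
        ‖secondDiff f (a + (2 * j + 1) * (ℓ / 2 ^ (i + 1))) (ℓ / 2 ^ (i + 1))‖ₑ ^ 2)
        (fun _ _ => zero_le) (Finset.mem_range.2 hj)
    have h2 : (16 / 9 : ℝ) ^ i * ‖D‖ ^ 2 ≤ T.toReal := by
      have := ENNReal.toReal_mono htop h1
      simpa using this
    have h3 : (‖D‖) ^ 2 ≤ (√T.toReal * (3 / 4) ^ i) ^ 2 := by
      rw [mul_pow, Real.sq_sqrt ENNReal.toReal_nonneg, ← pow_mul, mul_comm i 2, pow_mul]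
      have h4 : ((3 / 4 : ℝ) ^ 2) ^ i * (16 / 9 : ℝ) ^ i = 1 := by
        rw [← mul_pow]; norm_num
      calc ‖D‖ ^ 2 = ((16 / 9 : ℝ) ^ i * ‖D‖ ^ 2) * ((3 / 4 : ℝ) ^ 2) ^ i := by
            rw [mul_right_comm, mul_comm _ (((3 / 4 : ℝ) ^ 2) ^ i), h4, one_mul]
        _ ≤ _ := by gcongr
    exact (pow_le_pow_iff_left₀ (norm_nonneg _) (by positivity) two_ne_zero).1 h3
  have h := norm_sub_chord_le hf hℓ hd hs
  rw [← ofReal_norm, ← ENNReal.ofReal_pow (norm_nonneg _)]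
  refine (ENNReal.ofReal_le_ofReal (pow_le_pow_left₀ (norm_nonneg _) h 2)).trans ?_
  rw [mul_pow, Real.sq_sqrt ENNReal.toReal_nonneg, ENNReal.ofReal_mul (by positivity),
    ENNReal.ofReal_toReal htop]
  norm_num

lemma measurable_chordEnergy {f : ℝ → V} (hf : Continuous f) (c ℓ : ℝ) :
    Measurable fun t => chordEnergy f (t - c) ℓ := by
  unfold chordEnergy
  refine Measurable.tsum fun i => Measurable.const_mul (Finset.measurable_sum _ fun j _ => ?_) _
  exact ((continuous_secondDiff hf _).comp (by fun_prop : Continuous fun t : ℝ =>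
    t - c + (2 * j + 1) * (ℓ / 2 ^ (i + 1)))).enorm.measurable.pow_const 2

lemma lintegral_chordEnergy {f : ℝ → V} (hf : Continuous f) (c ℓ : ℝ) :
    ∫⁻ t, chordEnergy f (t - c) ℓ =
      ∑' i : ℕ, (32 / 9) ^ i * ∫⁻ t, ‖secondDiff f t (ℓ / 2 ^ (i + 1))‖ₑ ^ 2 := by
  have hm : ∀ (i j : ℕ), Measurable fun t =>
      ‖secondDiff f (t - c + (2 * j + 1) * (ℓ / 2 ^ (i + 1))) (ℓ / 2 ^ (i + 1))‖ₑ ^ 2 :=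
    fun i j => ((continuous_secondDiff hf _).comp (by fun_prop : Continuous fun t : ℝ =>
      t - c + (2 * j + 1) * (ℓ / 2 ^ (i + 1)))).enorm.measurable.pow_const 2
  unfold chordEnergy
  rw [lintegral_tsum fun i =>
    ((Finset.measurable_sum _ fun j _ => hm i j).const_mul _).aemeasurable]
  refine tsum_congr fun i => ?_
  rw [lintegral_const_mul _ (Finset.measurable_sum _ fun j _ => hm i j),
    lintegral_finsetSum _ fun j _ => hm i j]
  have : ∀ j : ℕ, ∫⁻ t,
      ‖secondDiff f (t - c + (2 * j + 1) * (ℓ / 2 ^ (i + 1))) (ℓ / 2 ^ (i + 1))‖ₑ ^ 2 =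
      ∫⁻ t, ‖secondDiff f t (ℓ / 2 ^ (i + 1))‖ₑ ^ 2 := fun j => by
    rw [← lintegral_add_right_eq_self (fun t => ‖secondDiff f t (ℓ / 2 ^ (i + 1))‖ₑ ^ 2)
      (-c + (2 * j + 1) * (ℓ / 2 ^ (i + 1)))]
    simp only [sub_eq_add_neg, add_assoc]
  simp only [this, Finset.sum_const, Finset.card_range, nsmul_eq_mul]
  rw [← mul_assoc]
  congr 1
  push_cast
  rw [← mul_pow]
  congr 1
  rw [div_eq_mul_inv, div_eq_mul_inv, mul_right_comm]
  norm_num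

/-- The Lipschitz square function estimate: the normalized deviations of `f` from its chords,
squared and summed over dyadic scales, are finite almost everywhere. -/
lemma ae_tsum_four_pow_mul_chordEnergy_lt_top {f : ℝ → V} {K : ℝ≥0}
    (hf : LipschitzWith K f) {a b : ℝ}
    (ha : ∀ t ≤ a, f t = f a) (hb : ∀ t, b ≤ t → f t = f b) {H : ℝ} (hH : 0 ≤ H) :
    ∀ᵐ t, ∑' k : ℕ, 4 ^ k * chordEnergy f (t - H / 2 ^ k) (2 * (H / 2 ^ k)) < ⊤ := by
  have hm : ∀ k : ℕ, Measurable fun t =>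
      4 ^ k * chordEnergy f (t - H / 2 ^ k) (2 * (H / 2 ^ k)) := fun k =>
    (measurable_chordEnergy hf.continuous _ _).const_mul _
  refine ae_lt_top (Measurable.tsum hm) (lt_top_iff_ne_top.1 ?_)
  rw [lintegral_tsum fun k => (hm k).aemeasurable]
  set W := ∑' j : ℕ, 4 ^ j * ∫⁻ t, ‖secondDiff f t (H / 2 ^ j)‖ₑ ^ 2 with hW
  have hWtop : W < ⊤ := tsum_four_pow_mul_lintegral_secondDiff_sq_lt_top hf ha hb hH
  have h89 : (8 / 9 : ℝ≥0∞) < 1 := by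
    rw [ENNReal.div_lt_iff (by simp) (by simp)]; norm_num
  calc _ = ∑' (k : ℕ) (i : ℕ), (8 / 9 : ℝ≥0∞) ^ i *
        (4 ^ (i + k) * ∫⁻ t, ‖secondDiff f t (H / 2 ^ (i + k))‖ₑ ^ 2) := by
        refine tsum_congr fun k => ?_
        rw [lintegral_const_mul _ (measurable_chordEnergy hf.continuous _ _),
          lintegral_chordEnergy hf.continuous, ← ENNReal.tsum_mul_left]
        refine tsum_congr fun i => ?_
        have e : 2 * (H / 2 ^ k) / 2 ^ (i + 1) = H / 2 ^ (i + k) := by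
          rw [pow_add, pow_add]; field_simp
        have e' : (32 / 9 : ℝ≥0∞) = 8 / 9 * 4 := by
          rw [div_eq_mul_inv, div_eq_mul_inv, mul_right_comm]
          norm_num
        rw [e, e', mul_pow, pow_add]
        ring
    _ = ∑' (i : ℕ), (8 / 9 : ℝ≥0∞) ^ i *
        ∑' k : ℕ, (4 ^ (i + k) * ∫⁻ t, ‖secondDiff f t (H / 2 ^ (i + k))‖ₑ ^ 2) := by
        rw [ENNReal.tsum_comm]
        simp only [ENNReal.tsum_mul_left]
    _ ≤ ∑' (i : ℕ), (8 / 9 : ℝ≥0∞) ^ i * W := by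
        gcongr with i
        exact ENNReal.tsum_comp_le_tsum_of_injective (add_right_injective i)
          fun j => 4 ^ j * ∫⁻ t, ‖secondDiff f t (H / 2 ^ j)‖ₑ ^ 2
    _ < ⊤ := by
        rw [ENNReal.tsum_mul_right, ENNReal.tsum_geometric]
        refine ENNReal.mul_lt_top (ENNReal.inv_lt_top.2 (tsub_pos_of_lt h89)) hWtop

end SquareFunction

section LipschitzImages

variable {V : Type*} [NormedAddCommGroup V] [NormedSpace ℝ V]

/-- The lower density of a locally finite measure is positive at almost every point of a
Lipschitz curve. -/
lemma ae_exists_mul_le_measure_closedBall [FiniteDimensional ℝ V] [MeasurableSpace V]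
    [BorelSpace V] (μ : Measure V) [IsLocallyFiniteMeasure μ] {F : ℝ → V} {K : ℝ≥0}
    (hF : LipschitzWith K F) (a b : ℝ) :
    ∀ᵐ x ∂μ, x ∈ F '' Icc a b →
      ∃ c > 0, ∀ r ∈ Ioc (0 : ℝ) 1, ENNReal.ofReal (c * r) ≤ μ (closedBall x r) := by
  set Z := {x | ¬ (x ∈ F '' Icc a b →
      ∃ c > 0, ∀ r ∈ Ioc (0 : ℝ) 1, ENNReal.ofReal (c * r) ≤ μ (closedBall x r))} with hZ
  change μ Z = 0
  have hfreq : ∀ x ∈ Z, ∀ ε > 0, ∃ᶠ r in 𝓝[>] (0 : ℝ),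
      μ (closedBall x r) ≤ ENNReal.ofReal (ε * r) := by
    intro x hx ε hε
    by_contra hcon
    rw [not_frequently] at hcon
    obtain ⟨r₀, hr₀, hsub⟩ := mem_nhdsGT_iff_exists_Ioc_subset.1 hcon
    rw [mem_Ioi] at hr₀
    refine hx fun _ => ⟨min ε (ε * r₀), lt_min hε (by positivity), fun r hr => ?_⟩
    rcases le_total r r₀ with h | h
    · have := hsub ⟨hr.1, h⟩
      rw [mem_ofPred_eq, not_le] at this
      refine le_trans (ENNReal.ofReal_le_ofReal ?_) this.le
      exact mul_le_mul_of_nonneg_right (min_le_left _ _) hr.1.le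
    · have := hsub ⟨hr₀, le_rfl⟩
      rw [mem_ofPred_eq, not_le] at this
      refine le_trans (ENNReal.ofReal_le_ofReal ?_)
        (this.le.trans (measure_mono (closedBall_subset_closedBall h)))
      calc min ε (ε * r₀) * r ≤ (ε * r₀) * 1 :=
            mul_le_mul (min_le_right _ _) hr.2 hr.1.le (by positivity)
        _ = _ := mul_one _
  set K' : ℝ≥0 := K + 1
  have hK' : (0 : ℝ) < K' := by positivity
  have hF' : LipschitzWith K' F := hF.weaken (by simp [K'])
  set ρ : Measure V := (volume.restrict (Icc (a - 1) (b + 1))).map F with hρ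
  have hFm : Measurable F := hF.continuous.measurable
  have hρball : ∀ x ∈ F '' Icc a b, ∀ r ∈ Ioc (0 : ℝ) K',
      ENNReal.ofReal (r / K') ≤ ρ (closedBall x r) := by
    rintro _ ⟨t, ht, rfl⟩ r hr
    rw [hρ, Measure.map_apply hFm measurableSet_closedBall,
      Measure.restrict_apply (hFm measurableSet_closedBall)]
    have hr1 : r / K' ≤ 1 := (div_le_one hK').2 hr.2
    have hsub : Icc t (t + r / K') ⊆ F ⁻¹' closedBall (F t) r ∩ Icc (a - 1) (b + 1) := by
      intro s hs
      refine ⟨?_, by linarith [ht.1, hs.1], by linarith [ht.2, hs.2]⟩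
      rw [mem_preimage, mem_closedBall]
      refine (hF'.dist_le_mul s t).trans ?_
      rw [Real.dist_eq, abs_of_nonneg (by linarith [hs.1])]
      have : s - t ≤ r / K' := by linarith [hs.2]
      rwa [le_div_iff₀' hK'] at this
    calc _ = volume (Icc t (t + r / K')) := by rw [Real.volume_Icc, add_sub_cancel_left]
      _ ≤ _ := measure_mono hsub
  have hle : ∀ ε : ℝ≥0, 0 < ε → μ Z ≤ ε * ρ univ := by
    intro ε hε
    have := (Besicovitch.vitaliFamily μ).measure_le_of_frequently_le (ρ := μ) (ε • ρ)
      Measure.AbsolutelyContinuous.rfl Z fun x hx => by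
        refine (Besicovitch.tendsto_filterAt μ x).frequently ?_
        have hx' : x ∈ F '' Icc a b := by
          rw [hZ, mem_ofPred_eq, Classical.not_imp] at hx
          exact hx.1
        refine ((hfreq x hx (ε / K') (by positivity)).and_eventually
          (Ioc_mem_nhdsGT hK')).mono fun r hr => hr.1.trans ?_
        calc ENNReal.ofReal (ε / K' * r) = ε * ENNReal.ofReal (r / K') := by
              rw [← ENNReal.ofReal_coe_nnreal, ← ENNReal.ofReal_mul (by positivity)]
              congr 1; ring
          _ ≤ ε * ρ (closedBall x r) := by gcongr; exact hρball x hx' r hr.2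
          _ = _ := by rw [Measure.smul_apply, ENNReal.smul_def, smul_eq_mul]
    refine this.trans ((measure_mono (subset_univ _)).trans ?_)
    rw [Measure.smul_apply, ENNReal.smul_def, smul_eq_mul]
  have hρfin : ρ univ ≠ ⊤ := by
    rw [hρ, Measure.map_apply hFm MeasurableSet.univ]
    simp
  refine le_antisymm (ENNReal.le_of_forall_pos_le_add fun ε hε _ => ?_) zero_le
  set R : ℝ≥0 := (ρ univ).toNNReal + 1
  have hR : ρ univ ≤ R := by
    rw [← ENNReal.coe_toNNReal hρfin]; exact_mod_cast le_self_add
  have hRpos : 0 < R := by positivity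
  calc μ Z ≤ (ε / R : ℝ≥0) * ρ univ := hle _ (by positivity)
    _ ≤ (ε / R : ℝ≥0) * R := by gcongr
    _ = 0 + ε := by rw [zero_add, ← ENNReal.coe_mul, div_mul_cancel₀ _ hRpos.ne']

/-- The image of the critical points of a curve has zero length. -/
lemma hausdorffMeasure_image_eq_zero_of_hasDerivAt_zero [MeasurableSpace V] [BorelSpace V]
    [SecondCountableTopology V] {F : ℝ → V} {Z : Set ℝ} (hZ : volume Z ≠ ⊤)
    (hF : ∀ t ∈ Z, HasDerivAt F 0 t) : μH[1] (F '' Z) = 0 := by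
  rcases Z.eq_empty_or_nonempty with rfl | hne
  · simp
  refine le_antisymm (ENNReal.le_of_forall_pos_le_add fun ε hε _ => ?_) zero_le
  set R : ℝ≥0 := (volume Z).toNNReal + 1
  have hR : volume Z ≤ R := by
    rw [← ENNReal.coe_toNNReal hZ]; exact_mod_cast le_self_add
  have hRpos : 0 < R := by positivity
  have hderiv : ∀ t ∈ Z, HasFDerivWithinAt F (0 : ℝ →L[ℝ] V) Z t := fun t ht => by
    simpa using (hF t ht).hasFDerivAt.hasFDerivWithinAt
  obtain ⟨T, A, hdisj, hT, hcov, happ, hA⟩ :=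
    exists_partition_approximatesLinearOn_of_hasFDerivWithinAt F Z (fun _ => 0) hderiv
      (fun _ => ε / R) (fun _ => by positivity)
  have hlip : ∀ i, LipschitzOnWith (ε / R) F (Z ∩ T i) := fun i => by
    obtain ⟨_, _, h0⟩ := hA hne i
    have h := happ i
    rw [h0] at h
    refine LipschitzOnWith.of_dist_le_mul fun x hx y hy => ?_
    simpa [dist_eq_norm] using h x hx y hy
  have hsub : F '' Z ⊆ ⋃ i, F '' (Z ∩ T i) := by
    rw [← image_iUnion, ← inter_iUnion, inter_eq_left.2 hcov]
  calc μH[1] (F '' Z) ≤ ∑' i, μH[1] (F '' (Z ∩ T i)) :=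
        (measure_mono hsub).trans (measure_iUnion_le _)
    _ ≤ ∑' i, (ε / R : ℝ≥0) * volume.restrict Z (T i) := by
        refine ENNReal.tsum_le_tsum fun i => ?_
        have := (hlip i).hausdorffMeasure_image_le zero_le_one
        rw [ENNReal.rpow_one, hausdorffMeasure_real] at this
        rwa [Measure.restrict_apply (hT i), inter_comm (T i)]
    _ = (ε / R : ℝ≥0) * volume.restrict Z (⋃ i, T i) := by
        rw [ENNReal.tsum_mul_left, measure_iUnion hdisj hT]
    _ ≤ (ε / R : ℝ≥0) * R := by
        gcongr
        exact (measure_mono (subset_univ _)).trans (by rwa [Measure.restrict_apply_univ])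
    _ = 0 + ε := by rw [zero_add, ← ENNReal.coe_mul, div_mul_cancel₀ _ hRpos.ne']

/-- The points of `[a, b]` where a curve has nonzero derivative are covered by countably many
compact sets on which the inverse of the curve is Lipschitz. -/
lemma exists_compact_antilipschitz_cover {F : ℝ → V} (hF : Continuous F) (a b : ℝ) :
    ∃ P : ℕ × ℤ → Set ℝ,
      (∀ i, IsCompact (P i) ∧ P i ⊆ Icc a b ∧
        ∃ M > 0, ∀ s ∈ P i, ∀ t ∈ P i, |s - t| ≤ M * dist (F s) (F t)) ∧
      ∀ t ∈ Icc a b, DifferentiableAt ℝ F t → deriv F t ≠ 0 → ∃ i, t ∈ P i := by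
  refine ⟨fun i => (Icc a b ∩ Icc ((i.2 : ℝ) / (i.1 + 1)) ((i.2 + 1) / (i.1 + 1))) ∩
    ⋂ u : ℝ, ⋂ _ : |u| ≤ 1 / (i.1 + 1), {t | |u| ≤ (i.1 + 1) * dist (F (t + u)) (F t)},
    fun i => ⟨?_, fun t ht => ht.1.1, (i.1 : ℝ) + 1, by positivity, ?_⟩, ?_⟩
  · refine (isCompact_Icc.inter_right isClosed_Icc).inter_right ?_
    refine isClosed_iInter fun u => isClosed_iInter fun _ => isClosed_le ?_ ?_ <;> fun_prop
  · intro s hs t ht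
    have h1 : |s - t| ≤ 1 / (i.1 + 1) := by
      have e : ((i.2 : ℝ) + 1) / (i.1 + 1) = i.2 / (i.1 + 1) + 1 / (i.1 + 1) := add_div _ _ _
      have h1 := hs.1.2
      have h2 := ht.1.2
      rw [e] at h1 h2
      rw [abs_le]
      constructor <;> linarith [h1.1, h1.2, h2.1, h2.2]
    have := mem_iInter₂.1 ht.2 (s - t) h1
    rwa [mem_ofPred_eq, add_sub_cancel] at this
  · intro t ht hd hne
    have hpos : 0 < ‖deriv F t‖ := norm_pos_iff.2 hne
    have h := (hasDerivAt_iff_isLittleO.1 hd.hasDerivAt).def (half_pos hpos)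
    obtain ⟨δ, hδ, hball⟩ := Metric.eventually_nhds_iff.1 h
    obtain ⟨m, hm⟩ := exists_nat_one_div_lt (lt_min hδ (half_pos hpos))
    have hm1 : (0 : ℝ) < m + 1 := by positivity
    refine ⟨(m, ⌊t * (m + 1)⌋), ⟨ht, ?_, ?_⟩, ?_⟩
    · rw [div_le_iff₀ hm1]; exact Int.floor_le _
    · rw [le_div_iff₀ hm1]; exact (Int.lt_floor_add_one _).le
    · refine mem_iInter₂.2 fun u hu => ?_
      have hu' : dist (t + u) t < δ := by
        rw [Real.dist_eq, add_sub_cancel_left]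
        exact hu.trans_lt (hm.trans_le (min_le_left _ _))
      have h1 := hball hu'
      rw [add_sub_cancel_left, Real.norm_eq_abs] at h1
      rw [mem_ofPred_eq, dist_eq_norm, ← div_le_iff₀' hm1]
      have h2 : |u| * ‖deriv F t‖ ≤ ‖F (t + u) - F t‖ + ‖deriv F t‖ / 2 * |u| := by
        rw [← Real.norm_eq_abs, ← norm_smul]
        refine (norm_le_norm_add_norm_sub' _ (F (t + u) - F t)).trans ?_
        exact add_le_add le_rfl (by rwa [norm_sub_rev])
      have h3 : 1 / ((m : ℝ) + 1) * |u| ≤ ‖deriv F t‖ / 2 * |u| :=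
        mul_le_mul_of_nonneg_right (hm.le.trans (min_le_right _ _)) (abs_nonneg u)
      rw [div_eq_mul_inv, ← one_div, mul_comm]
      linarith

end LipschitzImages

section ApproximationBySet

lemma sum_range_four_pow_mul_indicator_le {δ ρ : ℝ} (hδ : 0 ≤ δ) (N : ℕ) :
    ∑ k ∈ Finset.range N, (if δ ≤ ρ / 2 ^ k then 4 ^ k * δ ^ 2 else 0) ≤ 2 * ρ ^ 2 := by
  induction N with
  | zero => simp; positivity
  | succ N ih =>
    by_cases h : δ ≤ ρ / 2 ^ N
    · calc _ ≤ ∑ k ∈ Finset.range (N + 1), 4 ^ k * δ ^ 2 := by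
            refine Finset.sum_le_sum fun k _ => ?_
            split_ifs
            · exact le_rfl
            · positivity
        _ ≤ 2 * (4 ^ N * δ ^ 2) := by
            rw [← Finset.sum_mul, geom_sum_eq (by norm_num), pow_succ, ← mul_assoc]
            gcongr
            rw [div_le_iff₀ (by norm_num)]
            have : (0 : ℝ) < 4 ^ N := by positivity
            linarith
        _ ≤ 2 * (4 ^ N * (ρ / 2 ^ N) ^ 2) := by gcongr
        _ = 2 * ρ ^ 2 := by
            rw [div_pow, ← pow_mul, mul_comm N 2, pow_mul]
            norm_num
            field_simp
    · rw [Finset.sum_range_succ, if_neg h, add_zero]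
      exact ih

variable {V : Type*} [NormedAddCommGroup V] [MeasurableSpace V] [BorelSpace V] [ProperSpace V]

/-- A square function measuring how closely a locally finite measure is approximated by the
bi-Lipschitz image `F '' P` is finite at almost every point. -/
lemma ae_tsum_eight_pow_mul_setLIntegral_infDist_sq_lt_top [SecondCountableTopology V]
    (μ : Measure V) [IsLocallyFiniteMeasure μ] {F : ℝ → V} (hF : Continuous F) {P : Set ℝ}
    (hP : IsCompact P) {M : ℝ} (hM : 0 < M)
    (hPM : ∀ s ∈ P, ∀ t ∈ P, |s - t| ≤ M * dist (F s) (F t)) {ρ : ℝ} (hρ : 0 ≤ ρ) :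
    ∀ᵐ t ∂volume.restrict P, ∑' k : ℕ, 8 ^ k *
      ∫⁻ y in closedBall (F t) (ρ / 2 ^ k), ENNReal.ofReal (infDist y (F '' P) ^ 2) ∂μ < ⊤ := by
  rcases P.eq_empty_or_nonempty with rfl | hne
  · simp
  set A := F '' P with hA
  have hAc : IsCompact A := hP.image hF
  have hAne : A.Nonempty := hne.image F
  set g : V → ℝ≥0∞ := fun y => ENNReal.ofReal (infDist y A ^ 2) with hg
  have hgm : Measurable g := ((continuous_infDist_pt A).pow 2).measurable.ennreal_ofReal
  set S : ℕ → Set (ℝ × V) := fun k => {p | dist p.2 (F p.1) ≤ ρ / 2 ^ k} with hS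
  have hSm : ∀ k, MeasurableSet (S k) := fun k =>
    (isClosed_le (by fun_prop) continuous_const).measurableSet
  set φ : ℕ → ℝ × V → ℝ≥0∞ := fun k => (S k).indicator fun p => g p.2 with hφ
  have hφm : ∀ k, Measurable (φ k) := fun k => (hgm.comp measurable_snd).indicator (hSm k)
  have hball : ∀ (k : ℕ) (t : ℝ), ∫⁻ y in closedBall (F t) (ρ / 2 ^ k), g y ∂μ =
      ∫⁻ y, φ k (t, y) ∂μ := fun k t => by
    rw [← lintegral_indicator measurableSet_closedBall]
    rfl
  have hslice : ∀ (k : ℕ) (y : V), 8 ^ k * ∫⁻ t in P, φ k (t, y) ≤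
      ENNReal.ofReal (2 * M * ρ) *
        ENNReal.ofReal (if infDist y A ≤ ρ / 2 ^ k then 4 ^ k * infDist y A ^ 2 else 0) := by
    intro k y
    have h1 : ∫⁻ t in P, φ k (t, y) = g y * volume ({t | dist y (F t) ≤ ρ / 2 ^ k} ∩ P) := by
      have hm : MeasurableSet {t | dist y (F t) ≤ ρ / 2 ^ k} :=
        (isClosed_le (by fun_prop) continuous_const).measurableSet
      rw [← Measure.restrict_apply hm, ← setLIntegral_const, ← lintegral_indicator hm]
      rfl
    rw [h1]
    split_ifs with h
    · have h2 : volume ({t | dist y (F t) ≤ ρ / 2 ^ k} ∩ P) ≤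
          ENNReal.ofReal (2 * M * ρ / 2 ^ k) := by
        refine (Real.volume_le_diam _).trans (ediam_le fun s hs t ht => ?_)
        rw [edist_dist, Real.dist_eq]
        refine ENNReal.ofReal_le_ofReal ((hPM s hs.2 t ht.2).trans ?_)
        have h3 := dist_triangle_left (F s) (F t) y
        have h4 : dist y (F s) ≤ ρ / 2 ^ k := hs.1
        have h5 : dist y (F t) ≤ ρ / 2 ^ k := ht.1
        calc M * dist (F s) (F t) ≤ M * (ρ / 2 ^ k + ρ / 2 ^ k) := by gcongr; linarith
          _ = _ := by ring
      calc _ ≤ 8 ^ k * (g y * ENNReal.ofReal (2 * M * ρ / 2 ^ k)) := by gcongr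
        _ = _ := by
          rw [hg, ← ENNReal.ofReal_mul (by positivity), ← ENNReal.ofReal_mul (by positivity),
            ← ENNReal.ofReal_ofNat 8, ← ENNReal.ofReal_pow (by norm_num),
            ← ENNReal.ofReal_mul (by positivity)]
          congr 1
          rw [show (8 : ℝ) = 4 * 2 by norm_num, mul_pow]
          field_simp
    · have h2 : {t | dist y (F t) ≤ ρ / 2 ^ k} ∩ P = ∅ := by
        refine eq_empty_of_forall_notMem fun t ht => h ?_
        exact (infDist_le_dist_of_mem (mem_image_of_mem F ht.2)).trans ht.1
      simp [h2]
  have hsum : ∀ y, ∑' k : ℕ, 8 ^ k * ∫⁻ t in P, φ k (t, y) ≤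
      (cthickening ρ A).indicator (fun _ => ENNReal.ofReal (2 * M * ρ) *
        ENNReal.ofReal (2 * ρ ^ 2)) y := by
    intro y
    refine (ENNReal.tsum_le_tsum fun k => hslice k y).trans ?_
    rw [ENNReal.tsum_mul_left]
    by_cases hy : y ∈ cthickening ρ A
    · rw [indicator_of_mem hy]
      gcongr
      refine ENNReal.tsum_le_of_sum_range_le fun N => ?_
      rw [← ENNReal.ofReal_sum_of_nonneg fun k _ => by split_ifs <;> positivity]
      exact ENNReal.ofReal_le_ofReal (sum_range_four_pow_mul_indicator_le infDist_nonneg N)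
    · have : ∀ k : ℕ, ¬ infDist y A ≤ ρ / 2 ^ k := fun k hk => hy <| by
        obtain ⟨z, hz, hyz⟩ := hAc.exists_infDist_eq_dist hAne y
        refine mem_cthickening_of_dist_le y z ρ A hz ?_
        rw [← hyz]
        exact hk.trans (div_le_self hρ (one_le_pow₀ (by norm_num)))
      simp [this]
  have hm : ∀ k : ℕ, Measurable fun t => 8 ^ k * ∫⁻ y, φ k (t, y) ∂μ := fun k =>
    (hφm k).lintegral_prod_right'.const_mul _
  have hm' : ∀ k : ℕ, Measurable fun y => 8 ^ k * ∫⁻ t in P, φ k (t, y) := fun k =>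
    (hφm k).lintegral_prod_left'.const_mul _
  simp only [hball]
  refine ae_lt_top (Measurable.tsum hm) (lt_top_iff_ne_top.1 ?_)
  calc ∫⁻ t in P, ∑' k : ℕ, 8 ^ k * ∫⁻ y, φ k (t, y) ∂μ
      = ∑' k : ℕ, 8 ^ k * ∫⁻ t in P, ∫⁻ y, φ k (t, y) ∂μ := by
        rw [lintegral_tsum fun k => (hm k).aemeasurable]
        exact tsum_congr fun k => lintegral_const_mul _ (hφm k).lintegral_prod_right'
    _ = ∑' k : ℕ, 8 ^ k * ∫⁻ y, (∫⁻ t in P, φ k (t, y)) ∂μ := by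
        refine tsum_congr fun k => ?_
        rw [lintegral_lintegral_swap (f := fun t y => φ k (t, y)) (hφm k).aemeasurable]
    _ = ∫⁻ y, ∑' k : ℕ, 8 ^ k * (∫⁻ t in P, φ k (t, y)) ∂μ := by
        rw [lintegral_tsum fun k => (hm' k).aemeasurable]
        exact tsum_congr fun k => (lintegral_const_mul _ (hφm k).lintegral_prod_left').symm
    _ ≤ ∫⁻ y, (cthickening ρ A).indicator (fun _ => ENNReal.ofReal (2 * M * ρ) *
        ENNReal.ofReal (2 * ρ ^ 2)) y ∂μ := lintegral_mono hsum
    _ < ⊤ := by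
        rw [lintegral_indicator isClosed_cthickening.measurableSet, setLIntegral_const]
        exact ENNReal.mul_lt_top (by finiteness) hAc.cthickening.measure_lt_top

end ApproximationBySet

section Cubes

variable {n : ℕ} {k : ℤ} {z : Fin n → ℤ} {x : EuclideanSpace ℝ (Fin n)}

lemma isClosed_dilatedCube (n : ℕ) (lam : ℝ) (k : ℤ) (z : Fin n → ℤ) :
    IsClosed (dilatedCube n lam k z) := by
  rw [dilatedCube, ofPred_forall]
  exact isClosed_iInter fun i => isClosed_le (by fun_prop) continuous_const

lemma closedBall_subset_dilatedCube (hx : x ∈ dyadicCube n k z) :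
    closedBall x (2 ^ (-k)) ⊆ dilatedCube n 3 k z := by
  intro y hy i
  have h1 : |y i - x i| ≤ 2 ^ (-k) := by
    rw [mem_closedBall, dist_eq_norm] at hy
    exact (PiLp.norm_apply_le (y - x) i).trans hy
  have h2 := hx i
  rw [abs_le] at h1 ⊢
  constructor <;> linarith [h1.1, h1.2, h2.1, h2.2]

lemma dilatedCube_subset_closedBall (hx : x ∈ dyadicCube n k z) :
    dilatedCube n 3 k z ⊆ closedBall x (2 * n * 2 ^ (-k)) := by
  intro y hy
  have h1 : ∀ i, |y i - x i| ≤ 2 * 2 ^ (-k) := fun i => by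
    have h1 := hy i
    have h2 := hx i
    rw [abs_le] at h1 ⊢
    constructor <;> linarith [h1.1, h1.2, h2.1, h2.2]
  rw [mem_closedBall, dist_eq_norm, EuclideanSpace.norm_eq]
  have h2 : ∑ i, ‖(y - x).ofLp i‖ ^ 2 ≤ (∑ i, ‖(y - x).ofLp i‖) ^ 2 :=
    Finset.sum_sq_le_sq_sum_of_nonneg fun i _ => norm_nonneg _
  calc _ ≤ ∑ i, ‖(y - x).ofLp i‖ :=
        Real.sqrt_le_iff.2 ⟨Finset.sum_nonneg fun i _ => norm_nonneg _, h2⟩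
    _ ≤ ∑ _i : Fin n, 2 * (2 : ℝ) ^ (-k) := Finset.sum_le_sum fun i _ => h1 i
    _ = _ := by simp; ring

lemma zpow_le_diam_dilatedCube (hn : 0 < n) (hx : x ∈ dyadicCube n k z) :
    (2 : ℝ) ^ (-k) ≤ diam (dilatedCube n 3 k z) := by
  have hpos : (0 : ℝ) < 2 ^ (-k) := by positivity
  set y := x + EuclideanSpace.single (⟨0, hn⟩ : Fin n) ((2 : ℝ) ^ (-k)) with hy
  have hd : dist y x = 2 ^ (-k) := by
    rw [dist_eq_norm, hy, add_sub_cancel_left, PiLp.norm_single, Real.norm_eq_abs,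
      abs_of_pos hpos]
  rw [← hd]
  refine dist_le_diam_of_mem (isBounded_closedBall.subset (dilatedCube_subset_closedBall hx))
    (closedBall_subset_dilatedCube hx ?_)
    (closedBall_subset_dilatedCube hx (mem_closedBall_self hpos.le))
  rw [mem_closedBall, hd]

open Classical in
lemma tsum_ite_mem_dyadicCube_le (k : ℤ) (x : EuclideanSpace ℝ (Fin n)) (C : ℝ≥0∞) :
    ∑' z : Fin n → ℤ, (if x ∈ dyadicCube n k z then C else 0) ≤ 2 ^ n * C := by
  set u : Fin n → ℝ := fun i => x i * 2 ^ k with hu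
  set s : Finset (Fin n → ℤ) := Fintype.piFinset fun i => Finset.Icc (⌊u i⌋ - 1) ⌊u i⌋ with hs
  have hsub : ∀ z ∉ s, (if x ∈ dyadicCube n k z then C else 0) = 0 := by
    intro z hz
    refine if_neg fun hx => hz (Fintype.mem_piFinset.2 fun i => ?_)
    have hpos : (0 : ℝ) < 2 ^ k := by positivity
    obtain ⟨h1, h2⟩ := hx i
    rw [zpow_neg, ← div_eq_mul_inv] at h1 h2
    rw [div_le_iff₀ hpos] at h1
    rw [le_div_iff₀ hpos] at h2
    rw [Finset.mem_Icc]
    refine ⟨?_, Int.le_floor.2 h1⟩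
    have : ⌊u i⌋ ≤ z i + 1 := by
      refine (Int.floor_le_floor h2).trans ?_
      rw [← Int.cast_one, ← Int.cast_add, Int.floor_intCast]
    omega
  rw [tsum_eq_sum hsub]
  calc _ ≤ ∑ _z ∈ s, C := Finset.sum_le_sum fun z _ => by split_ifs <;> simp
    _ = _ := by
      rw [Finset.sum_const, hs, Fintype.card_piFinset]
      simp

open Classical in
lemma jones2_one_eq (μ : Measure (EuclideanSpace ℝ (Fin n))) (x : EuclideanSpace ℝ (Fin n)) :
    jones2 μ 1 x = ∑' (k : ℕ) (z : Fin n → ℤ),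
      if x ∈ dyadicCube n k z then beta2Sq μ (dilatedCube n 3 k z) else 0 := by
  have hle : ∀ k : ℤ, (2 : ℝ) ^ (-k) ≤ 1 ↔ 0 ≤ k := fun k => by
    rw [zpow_le_one_iff_right₀ (by norm_num), neg_nonpos]
  simp only [jones2, hle]
  rw [← Function.Injective.tsum_eq (g := ((↑) : ℕ → ℤ)) Nat.cast_injective]
  · simp
  · intro k hk
    by_contra hcon
    refine hk ?_
    have : ¬ 0 ≤ k := fun h => hcon ⟨k.toNat, by simp [h]⟩
    simp [this]

lemma jones2_one_le {μ : Measure (EuclideanSpace ℝ (Fin n))} {x : EuclideanSpace ℝ (Fin n)}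
    {B : ℕ → ℝ≥0∞}
    (hB : ∀ (k : ℕ) (z : Fin n → ℤ), x ∈ dyadicCube n k z →
      beta2Sq μ (dilatedCube n 3 k z) ≤ B k) :
    jones2 μ 1 x ≤ 2 ^ n * ∑' k, B k := by
  classical
  rw [jones2_one_eq, ← ENNReal.tsum_mul_left]
  refine ENNReal.tsum_le_tsum fun k => le_trans (ENNReal.tsum_le_tsum fun z => ?_)
    (tsum_ite_mem_dyadicCube_le k x (B k))
  split_ifs with h
  · exact hB k z h
  · exact le_rfl

lemma exists_isLine_forall_mem (hn : 0 < n) (p w : EuclideanSpace ℝ (Fin n)) :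
    ∃ L, IsLine L ∧ ∀ u : ℝ, p + u • w ∈ L := by
  by_cases hw : w = 0
  · refine ⟨_, ⟨p, EuclideanSpace.single (⟨0, hn⟩ : Fin n) 1, ?_, rfl⟩, fun u => ⟨0, by simp [hw]⟩⟩
    simp
  · exact ⟨_, ⟨p, w, hw, rfl⟩, fun u => ⟨u, rfl⟩⟩

lemma beta2Sq_le {μ : Measure (EuclideanSpace ℝ (Fin n))} {Q L : Set (EuclideanSpace ℝ (Fin n))}
    (hQ : MeasurableSet Q) (hQ0 : μ Q ≠ 0) (hQt : μ Q ≠ ⊤) {d : ℝ} (hd : 0 < d)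
    (hdQ : d ≤ diam Q) (hL : IsLine L) {g : EuclideanSpace ℝ (Fin n) → ℝ≥0∞}
    {T : ℝ≥0∞} (hgT : ∀ y ∈ Q, ENNReal.ofReal (infDist y L ^ 2) ≤ g y + T) :
    beta2Sq μ Q ≤ ENNReal.ofReal ((d ^ 2)⁻¹) * ((∫⁻ y in Q, g y ∂μ) / μ Q + T) := by
  refine (iInf₂_le L hL).trans ?_
  have h1 : ∀ y ∈ Q, ENNReal.ofReal ((infDist y L / diam Q) ^ 2) ≤
      ENNReal.ofReal ((d ^ 2)⁻¹) * (g y + T) := fun y hy => by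
    calc _ ≤ ENNReal.ofReal ((d ^ 2)⁻¹ * infDist y L ^ 2) := by
          refine ENNReal.ofReal_le_ofReal ?_
          have := infDist_nonneg (x := y) (s := L)
          rw [inv_mul_eq_div, ← div_pow]
          gcongr
      _ ≤ _ := by
          rw [ENNReal.ofReal_mul (by positivity)]
          gcongr
          exact hgT y hy
  rw [ENNReal.div_le_iff hQ0 hQt]
  calc _ ≤ ∫⁻ y in Q, ENNReal.ofReal ((d ^ 2)⁻¹) * (g y + T) ∂μ := setLIntegral_mono' hQ h1
    _ = ENNReal.ofReal ((d ^ 2)⁻¹) * ((∫⁻ y in Q, g y ∂μ) + T * μ Q) := by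
        rw [lintegral_const_mul' _ _ ENNReal.ofReal_ne_top,
          lintegral_add_right _ measurable_const, setLIntegral_const]
    _ = _ := by
        rw [mul_assoc, add_mul, ENNReal.div_mul_cancel hQ0 hQt]

/-- The beta number of a cube centred near the bi-Lipschitz piece `F '' P` is controlled by the
distance of the measure to the piece and by the deviation of `F` from a chord. -/
lemma beta2Sq_dilatedCube_le (hn : 0 < n) {μ : Measure (EuclideanSpace ℝ (Fin n))}
    [IsLocallyFiniteMeasure μ] {F : ℝ → EuclideanSpace ℝ (Fin n)} (hF : Continuous F)
    {P : Set ℝ} (hP : IsCompact P) {M : ℝ} (hM : 0 < M)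
    (hPM : ∀ s ∈ P, ∀ t ∈ P, |s - t| ≤ M * dist (F s) (F t)) {c : ℝ} (hc : 0 < c) {t : ℝ}
    (ht : t ∈ P)
    (hlow : ∀ r ∈ Ioc (0 : ℝ) 1, ENNReal.ofReal (c * r) ≤ μ (closedBall (F t) r))
    {k : ℕ} {z : Fin n → ℤ} (hx : F t ∈ dyadicCube n k z) :
    beta2Sq μ (dilatedCube n 3 k z) ≤
      ENNReal.ofReal (2 / c) * (8 ^ k * ∫⁻ y in closedBall (F t) (2 * n / 2 ^ k),
        ENNReal.ofReal (infDist y (F '' P) ^ 2) ∂μ) +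
      8 * (4 ^ k * chordEnergy F (t - M * (4 * n) / 2 ^ k) (2 * (M * (4 * n) / 2 ^ k))) := by
  set H : ℝ := M * (4 * n) / 2 ^ k with hH
  have hn' : (0 : ℝ) < n := by exact_mod_cast hn
  have hHpos : 0 < H := by positivity
  set T := chordEnergy F (t - H) (2 * H) with hT
  set Q := dilatedCube n 3 k z with hQ
  have hzp : (2 : ℝ) ^ (-(k : ℤ)) = 1 / 2 ^ k := by rw [zpow_neg, zpow_natCast, one_div]
  have hball : closedBall (F t) (1 / 2 ^ k) ⊆ Q := hzp ▸ closedBall_subset_dilatedCube hx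
  have hsub : Q ⊆ closedBall (F t) (2 * n / 2 ^ k) := by
    have := dilatedCube_subset_closedBall hx
    rwa [hzp, mul_one_div] at this
  have hdiam : 1 / 2 ^ k ≤ diam Q := hzp ▸ zpow_le_diam_dilatedCube hn hx
  have hlowQ : ENNReal.ofReal (c * (1 / 2 ^ k)) ≤ μ Q :=
    (hlow _ ⟨by positivity, by
      rw [div_le_one (by positivity)]; exact one_le_pow₀ (by norm_num)⟩).trans (measure_mono hball)
  have hQ0 : μ Q ≠ 0 := (lt_of_lt_of_le (ENNReal.ofReal_pos.2 (by positivity)) hlowQ).ne'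
  have hQt : μ Q ≠ ⊤ :=
    ((measure_mono hsub).trans_lt (isCompact_closedBall _ _).measure_lt_top).ne
  obtain ⟨L, hL, hmem⟩ := exists_isLine_forall_mem hn (F (t - H)) (F (t - H + 2 * H) - F (t - H))
  have hAc : IsCompact (F '' P) := hP.image hF
  have hgT : ∀ y ∈ Q, ENNReal.ofReal (infDist y L ^ 2) ≤
      2 * ENNReal.ofReal (infDist y (F '' P) ^ 2) + 8 * T := by
    intro y hy
    obtain ⟨_, ⟨s, hs, rfl⟩, hys⟩ :=
      hAc.exists_infDist_eq_dist ⟨F t, mem_image_of_mem F ht⟩ y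
    have hyt : dist y (F t) ≤ 2 * n / 2 ^ k := hsub hy
    have hys' : dist y (F s) ≤ 2 * n / 2 ^ k := by
      rw [← hys]; exact (infDist_le_dist_of_mem (mem_image_of_mem F ht)).trans hyt
    have hst : |s - t| ≤ H := by
      refine (hPM s hs t ht).trans ?_
      rw [hH, mul_div_assoc]
      gcongr
      have := dist_triangle_left (F s) (F t) y
      calc _ ≤ 2 * (n : ℝ) / 2 ^ k + 2 * n / 2 ^ k := by linarith
        _ = _ := by ring
    have hsI : s ∈ Icc (t - H) (t - H + 2 * H) := by
      rw [abs_le] at hst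
      constructor <;> linarith [hst.1, hst.2]
    have hchord := enorm_sub_chord_sq_le hF (by positivity : 0 < 2 * H) hsI
    set q := F (t - H) + ((s - (t - H)) / (2 * H)) • (F (t - H + 2 * H) - F (t - H)) with hq
    have hyL : infDist y L ≤ infDist y (F '' P) + ‖F s - q‖ := by
      rw [hys, ← dist_eq_norm]
      exact (infDist_le_dist_of_mem (hmem _)).trans (dist_triangle _ _ _)
    have hsq : infDist y L ^ 2 ≤ 2 * infDist y (F '' P) ^ 2 + 2 * ‖F s - q‖ ^ 2 := by
      refine (pow_le_pow_left₀ infDist_nonneg hyL 2).trans ?_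
      nlinarith [sq_nonneg (infDist y (F '' P) - ‖F s - q‖)]
    calc _ ≤ ENNReal.ofReal (2 * infDist y (F '' P) ^ 2 + 2 * ‖F s - q‖ ^ 2) :=
          ENNReal.ofReal_le_ofReal hsq
      _ = 2 * ENNReal.ofReal (infDist y (F '' P) ^ 2) + 2 * ‖F s - q‖ₑ ^ 2 := by
          rw [ENNReal.ofReal_add (by positivity) (by positivity),
            ENNReal.ofReal_mul (by positivity), ENNReal.ofReal_mul (by positivity),
            ENNReal.ofReal_pow (norm_nonneg _), ofReal_norm, ENNReal.ofReal_ofNat]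
      _ ≤ 2 * ENNReal.ofReal (infDist y (F '' P) ^ 2) + 2 * (4 * T) := by gcongr
      _ = _ := by rw [← mul_assoc]; norm_num
  have hmain := beta2Sq_le (isClosed_dilatedCube n 3 k z).measurableSet hQ0 hQt
    (by positivity : (0 : ℝ) < 1 / 2 ^ k) hdiam hL hgT
  refine hmain.trans ?_
  have h4 : ENNReal.ofReal (((1 / 2 ^ k : ℝ) ^ 2)⁻¹) = 4 ^ k := by
    rw [div_pow, one_pow, one_div, inv_inv, ← pow_mul, mul_comm, pow_mul,
      ENNReal.ofReal_pow (by norm_num)]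
    norm_num
  rw [h4, mul_add, mul_left_comm (4 ^ k) 8 T]
  refine add_le_add_left ?_ _
  rw [lintegral_const_mul' _ _ (by simp)]
  set I := ∫⁻ y in closedBall (F t) (2 * n / 2 ^ k), ENNReal.ofReal (infDist y (F '' P) ^ 2) ∂μ
  calc 4 ^ k * (2 * (∫⁻ y in Q, ENNReal.ofReal (infDist y (F '' P) ^ 2) ∂μ) / μ Q)
      ≤ 4 ^ k * (2 * I / ENNReal.ofReal (c * (1 / 2 ^ k))) := by
        gcongr
        exact lintegral_mono_set hsub
    _ = _ := by
        rw [div_eq_mul_inv, ← ENNReal.ofReal_inv_of_pos (by positivity)]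
        have e : (c * (1 / 2 ^ k))⁻¹ = 1 / c * 2 ^ k := by field_simp
        have e2 : ENNReal.ofReal (2 / c) = 2 * ENNReal.ofReal (1 / c) := by
          rw [← ENNReal.ofReal_ofNat 2, ← ENNReal.ofReal_mul (by norm_num), mul_one_div]
        rw [e, e2, ENNReal.ofReal_mul (by positivity), ENNReal.ofReal_pow (by norm_num),
          ENNReal.ofReal_ofNat, show (8 : ℝ≥0∞) = 4 * 2 by norm_num, mul_pow]
        ring

/-- The Jones function is finite at almost every point of a bi-Lipschitz image of a compact set
of parameters. -/
lemma ae_jones2_lt_top_of_antilipschitz (hn : 0 < n) (μ : Measure (EuclideanSpace ℝ (Fin n)))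
    [IsLocallyFiniteMeasure μ] {F : ℝ → EuclideanSpace ℝ (Fin n)} {K : ℝ≥0}
    (hF : LipschitzWith K F) {a b : ℝ} (ha : ∀ t ≤ a, F t = F a) (hb : ∀ t, b ≤ t → F t = F b)
    {P : Set ℝ} (hP : IsCompact P) {M : ℝ} (hM : 0 < M)
    (hPM : ∀ s ∈ P, ∀ t ∈ P, |s - t| ≤ M * dist (F s) (F t)) :
    ∀ᵐ t, t ∈ P →
      (∃ c > 0, ∀ r ∈ Ioc (0 : ℝ) 1, ENNReal.ofReal (c * r) ≤ μ (closedBall (F t) r)) →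
      jones2 μ 1 (F t) < ⊤ := by
  have h1 := ae_tsum_eight_pow_mul_setLIntegral_infDist_sq_lt_top μ hF.continuous hP hM hPM
    (ρ := 2 * n) (by positivity)
  rw [ae_restrict_iff' hP.measurableSet] at h1
  have h2 := ae_tsum_four_pow_mul_chordEnergy_lt_top hF ha hb (H := M * (4 * n)) (by positivity)
  filter_upwards [h1, h2] with t h1 h2 ht ⟨c, hc, hlow⟩
  refine (jones2_one_le fun k z hx =>
    beta2Sq_dilatedCube_le hn hF.continuous hP hM hPM hc ht hlow hx).trans_lt ?_
  rw [ENNReal.tsum_add, ENNReal.tsum_mul_left, ENNReal.tsum_mul_left]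
  have := h1 ht
  finiteness

/-- The Jones function is finite at almost every point of a Lipschitz curve which is constant on
both sides of a compact interval. -/
lemma ae_jones2_lt_top_of_mem_image_Icc (hn : 0 < n) {μ : Measure (EuclideanSpace ℝ (Fin n))}
    [IsLocallyFiniteMeasure μ] (hac : μ ≪ μH[1]) {F : ℝ → EuclideanSpace ℝ (Fin n)} {K : ℝ≥0}
    (hF : LipschitzWith K F) {a b : ℝ} (ha : ∀ t ≤ a, F t = F a)
    (hb : ∀ t, b ≤ t → F t = F b) :
    ∀ᵐ x ∂μ, x ∈ F '' Icc a b → jones2 μ 1 x < ⊤ := by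
  have hnull : ∀ N : Set ℝ, volume N = 0 → μ (F '' N) = 0 := fun N hN => hac <| by
    have := (hF.lipschitzOnWith (s := N)).hausdorffMeasure_image_le zero_le_one
    simpa [hausdorffMeasure_real, hN] using this
  obtain ⟨P, hP, hcov⟩ := exists_compact_antilipschitz_cover hF.continuous a b
  have hgood : ∀ᵐ t, ∀ i, t ∈ P i →
      (∃ c > 0, ∀ r ∈ Ioc (0 : ℝ) 1, ENNReal.ofReal (c * r) ≤ μ (closedBall (F t) r)) →
      jones2 μ 1 (F t) < ⊤ := ae_all_iff.2 fun i => by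
    obtain ⟨hc, -, M, hM, hPM⟩ := hP i
    exact ae_jones2_lt_top_of_antilipschitz hn μ hF ha hb hc hM hPM
  have hbad := hnull _ (ae_iff.1 (hgood.and hF.ae_differentiableAt))
  have hcrit : μ (F '' {t | t ∈ Icc a b ∧ HasDerivAt F 0 t}) = 0 :=
    hac (hausdorffMeasure_image_eq_zero_of_hasDerivAt_zero
      ((measure_mono fun t ht => ht.1).trans_lt measure_Icc_lt_top).ne fun t ht => ht.2)
  filter_upwards [ae_exists_mul_le_measure_closedBall μ hF a b,
    measure_eq_zero_iff_ae_notMem.1 hbad, measure_eq_zero_iff_ae_notMem.1 hcrit]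
    with x hlow hx1 hx2 hx
  have hlow := hlow hx
  obtain ⟨t, ht, rfl⟩ := hx
  have h1 := not_not.1 fun h => hx1 ⟨t, h, rfl⟩
  have h2 : deriv F t ≠ 0 := fun h => hx2 ⟨t, ⟨ht, h ▸ h1.2.hasDerivAt⟩, rfl⟩
  obtain ⟨i, hi⟩ := hcov t ht h1.2 h2
  exact h1.1 i hi hlow

end Cubes

/-- If `n ≥ 2` and `μ` is a locally finite Borel measure on `ℝⁿ` which is
`1`-rectifiable and absolutely continuous with respect to `H¹`, then `J₂(μ,x) < ∞` at
`μ`-a.e. `x ∈ ℝⁿ`. -/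
theorem jones2_lt_top_ae_of_is1Rectifiable_of_ac (n : ℕ) (hn : 2 ≤ n)
    (μ : Measure (EuclideanSpace ℝ (Fin n))) [IsLocallyFiniteMeasure μ]
    (hμ : Is1Rectifiable μ) (hac : μ ≪ μH[1]) :
    ∀ᵐ x ∂μ, jones2 μ 1 x < ⊤ := by
  obtain ⟨E, f, hf, hcov⟩ := hμ
  have key : ∀ i, ∀ᵐ x ∂μ, x ∈ f i '' E i → jones2 μ 1 x < ⊤ := fun i => by
    obtain ⟨hbdd, -, K, hK⟩ := hf i
    obtain ⟨g, hg, hgf⟩ := hK.extend_finite_dimension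
    obtain ⟨R, hR0, hR⟩ := hbdd.subset_closedBall_lt 0 0
    rw [Real.closedBall_eq_Icc, zero_sub, zero_add] at hR
    have hRR : -R ≤ R := by linarith
    set F := IccExtend hRR (fun t => g t) with hFdef
    have hF : LipschitzWith _ F :=
      hg.comp (LipschitzWith.subtype_val _ |>.comp (LipschitzWith.projIcc hRR))
    have hmem : ∀ t ∈ Icc (-R) R, F t = g t := fun t ht => IccExtend_of_mem hRR _ ht
    have := ae_jones2_lt_top_of_mem_image_Icc (by omega) hac hF (a := -R) (b := R)
      (fun t ht => by rw [hFdef, IccExtend_of_le_left hRR _ ht, IccExtend_left])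
      (fun t ht => by rw [hFdef, IccExtend_of_right_le hRR _ ht, IccExtend_right])
    filter_upwards [this] with x hx
    rintro ⟨t, ht, rfl⟩
    exact hx ⟨t, hR ht, by rw [hmem t (hR ht), hgf ht]⟩
  filter_upwards [ae_all_iff.2 key, measure_eq_zero_iff_ae_notMem.1 hcov] with x hx hxc
  obtain ⟨i, hi⟩ := mem_iUnion.1 (not_not.1 fun h => hxc ⟨mem_univ x, h⟩)
  exact hx i hi

end
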